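/- Let B be a unital complex Banach algebra, take I = {1,2} in the Fock-space construction, let α₀ ∈ B be invertible, let N ≥ 1, choose bounded n-multilinear maps α_n : Bⁿ → B for n ∈ {1,…,N}, and set F(b) = α₀ + Σ_{n=1}^{N} α_n(b,…,b) (so F(b) is invertible for ‖b‖ sufficiently small). Let X = Σ_{n=0}^{N} (V_{1,n}(α_n) + W_{1,n}(α_n)) ∈ B(𝔉). Then, with respect to the expectation ℰ, the S-transform of X satisfies S_X(b) = F(b)^{-1} for all b in a neighborhood of 0 in B. -/

import Mathlib

open scoped Topology ENNReal

noncomputable section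

variable (B : Type*) [NormedRing B] [NormedAlgebra ℂ B] [CompleteSpace B]
variable (I : Type*) [DecidableEq I]

abbrev D := lp (fun _ : I => B) 1

def delta (i : I) : D B I := lp.single 1 i (1 : B)

def lsmul (b : B) (d : D B I) : D B I :=
  ⟨fun i => b * d i, by
    apply memℓp_gen
    have h1 : Summable fun i => ‖d i‖ ^ (1 : ℝ≥0∞).toReal :=
      (lp.memℓp d).summable (by norm_num)
    simp only [ENNReal.toReal_one, Real.rpow_one] at h1 ⊢
    exact Summable.of_nonneg_of_le (fun i => norm_nonneg _)
      (fun i => norm_mul_le b (d i)) (h1.mul_left ‖b‖)⟩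

/-- The Fock-space construction of Dykema's paper: `F` plays the role of
`𝔉 = BΩ ⊕ ⨁_{k ≥ 1} D^{⊗̂k} ⊗̂ B`, with `τ k d b₀` the elementary tensor
`d 0 ⊗ ⋯ ⊗ d k ⊗ b₀` (`k+1` factors from `D`), `lam` the left action of `B`,
`rho` the right action of `B`, `P` the projection onto `BΩ` and the operators
`L i`, `V i n αₙ`, `W i n αₙ` as defined in the paper. -/
structure FockSetup (F : Type*) [NormedAddCommGroup F] [NormedSpace ℂ F] [CompleteSpace F] where
  Ω : F
  τ : (k : ℕ) → (Fin (k + 1) → D B I) → B → F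
  lam : B →ₐ[ℂ] (F →L[ℂ] F)
  rho : B → (F →L[ℂ] F)
  P : F →L[ℂ] B
  L : I → (F →L[ℂ] F)
  V : (i : I) → (n : ℕ) → ContinuousMultilinearMap ℂ (fun _ : Fin n => B) B → (F →L[ℂ] F)
  W : (i : I) → (n : ℕ) → ContinuousMultilinearMap ℂ (fun _ : Fin n => B) B → (F →L[ℂ] F)
  dense_span : Dense (↑(Submodule.span ℂ
      ((Set.range fun b : B => lam b Ω) ∪
        {x | ∃ (k : ℕ) (d : Fin (k + 1) → D B I) (b₀ : B), x = τ k d b₀})) : Set F)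
  lam_tensor : ∀ (b : B) (k : ℕ) (d : Fin (k + 1) → D B I) (b₀ : B),
    lam b (τ k d b₀) = τ k (Function.update d 0 (lsmul B I b (d 0))) b₀
  rho_lam_omega : ∀ b b₀ : B, rho b (lam b₀ Ω) = lam (b₀ * b) Ω
  rho_tensor : ∀ (b : B) (k : ℕ) (d : Fin (k + 1) → D B I) (b₀ : B),
    rho b (τ k d b₀) = τ k d (b₀ * b)
  P_lam_omega : ∀ b : B, P (lam b Ω) = b
  P_tensor : ∀ (k : ℕ) (d : Fin (k + 1) → D B I) (b₀ : B), P (τ k d b₀) = 0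
  L_omega : ∀ (i : I) (b₀ : B), L i (lam b₀ Ω) = τ 0 (fun _ => delta B I i) b₀
  L_tensor : ∀ (i : I) (k : ℕ) (d : Fin (k + 1) → D B I) (b₀ : B),
    L i (τ k d b₀) = τ (k + 1) (Fin.cons (delta B I i) d) b₀
  V_zero : ∀ (i : I) (α : ContinuousMultilinearMap ℂ (fun _ : Fin 0 => B) B),
    V i 0 α = lam (α 0)
  W_zero : ∀ (i : I) (α : ContinuousMultilinearMap ℂ (fun _ : Fin 0 => B) B),
    W i 0 α = lam (α 0) * L i
  V_omega : ∀ (i : I) (n : ℕ), 1 ≤ n →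
    ∀ (α : ContinuousMultilinearMap ℂ (fun _ : Fin n => B) B) (b₀ : B),
      V i n α (lam b₀ Ω) = 0
  W_omega : ∀ (i : I) (n : ℕ), 1 ≤ n →
    ∀ (α : ContinuousMultilinearMap ℂ (fun _ : Fin n => B) B) (b₀ : B),
      W i n α (lam b₀ Ω) = 0
  V_tensor_lt : ∀ (i : I) (n : ℕ) (α : ContinuousMultilinearMap ℂ (fun _ : Fin n => B) B)
      (k : ℕ) (d : Fin (k + 1) → D B I) (b₀ : B), k + 1 < n →
    V i n α (τ k d b₀) = 0
  W_tensor_lt : ∀ (i : I) (n : ℕ) (α : ContinuousMultilinearMap ℂ (fun _ : Fin n => B) B)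
      (k : ℕ) (d : Fin (k + 1) → D B I) (b₀ : B), k + 1 < n →
    W i n α (τ k d b₀) = 0
  V_tensor_eq : ∀ (i : I) (k : ℕ) (α : ContinuousMultilinearMap ℂ (fun _ : Fin (k + 1) => B) B)
      (d : Fin (k + 1) → D B I) (b₀ : B),
    V i (k + 1) α (τ k d b₀) = lam (α (fun j => d j i) * b₀) Ω
  W_tensor_eq : ∀ (i : I) (k : ℕ) (α : ContinuousMultilinearMap ℂ (fun _ : Fin (k + 1) => B) B)
      (d : Fin (k + 1) → D B I) (b₀ : B),
    W i (k + 1) α (τ k d b₀) = lam (α (fun j => d j i)) (τ 0 (fun _ => delta B I i) b₀)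
  V_tensor_gt : ∀ (i : I) (n : ℕ), 1 ≤ n →
    ∀ (α : ContinuousMultilinearMap ℂ (fun _ : Fin n => B) B)
      (k : ℕ) (d : Fin (k + 1) → D B I) (b₀ : B) (h : n ≤ k),
    V i n α (τ k d b₀) =
      lam (α fun j => d (Fin.castLE (by omega) j) i)
        (τ (k - n) (fun j : Fin (k - n + 1) => d ⟨n + (j : ℕ), by omega⟩) b₀)
  W_tensor_gt : ∀ (i : I) (n : ℕ), 1 ≤ n →
    ∀ (α : ContinuousMultilinearMap ℂ (fun _ : Fin n => B) B)
      (k : ℕ) (d : Fin (k + 1) → D B I) (b₀ : B) (h : n ≤ k),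
    W i n α (τ k d b₀) =
      lam (α fun j => d (Fin.castLE (by omega) j) i)
        (τ (k - n + 1) (Fin.cons (delta B I i)
          (fun j : Fin (k - n + 1) => d ⟨n + (j : ℕ), by omega⟩)) b₀)

variable {B} {I}
variable {F : Type*} [NormedAddCommGroup F] [NormedSpace ℂ F] [CompleteSpace F]

/-- The expectation `ℰ(X) = P(XΩ)`. -/
def FockSetup.Ec (S : FockSetup B I F) (X : F →L[ℂ] F) : B := S.P (X S.Ω)

/-- `Ψ_X(b) = ℰ((1 - bX)⁻¹) - 1` for an operator `X` on the Fock space (with `b` acting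
via `λ`). -/
def FockSetup.Psi (S : FockSetup B I F) (X : F →L[ℂ] F) (b : B) : B :=
  S.Ec (Ring.inverse (1 - S.lam b * X)) - 1

/-- `Sx` is (a version of) the S-transform of `X` with respect to `ℰ`:  `Sx(b) = (1+b) H(b)`
where `H` is analytic near `0` and `b ↦ b H(b)` is a local right inverse of `Ψ_X`. -/
def FockSetup.IsSTransform (S : FockSetup B I F) (X : F →L[ℂ] F) (Sx : B → B) : Prop :=
  ∃ H : B → B, AnalyticAt ℂ H 0 ∧ (∀ᶠ b in nhds (0 : B), S.Psi X (b * H b) = b) ∧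
    ∀ᶠ b in nhds (0 : B), Sx b = (1 + b) * H b

set_option linter.unusedSectionVars false

/-- In a family of vectors, each vector can be separated from its predecessors by a continuous
functional, provided the family is linearly independent. -/
theorem LinearIndependent.exists_strongDual_triangular {E : Type*} [NormedAddCommGroup E]
    [NormedSpace ℂ E] {e : ℕ → E} (he : LinearIndependent ℂ e) (n : ℕ) :
    ∃ f : E →L[ℂ] ℂ, f (e n) = 1 ∧ ∀ m < n, f (e m) = 0 := by
  have hli : LinearIndependent ℂ fun j : Fin (n + 1) => e j :=
    he.comp _ Fin.val_injective
  have hinj : Function.Injective (Fintype.linearCombination ℂ fun j : Fin (n + 1) => e j) :=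
    hli.fintypeLinearCombination_injective
  obtain ⟨f, hf⟩ := (SeparatingDual.dualMap_surjective_iff (R := ℂ)).mpr hinj
    (LinearMap.proj (Fin.last n))
  have key : ∀ j : Fin (n + 1), f (e j) = (Pi.single j (1 : ℂ) : Fin (n + 1) → ℂ) (Fin.last n) := by
    intro j
    have h := LinearMap.congr_fun hf (Pi.single j 1)
    simpa [Fintype.linearCombination_apply_single] using h
  refine ⟨f, by simpa using key (Fin.last n), fun m hm => ?_⟩
  have h := key ⟨m, by omega⟩
  rwa [Pi.single_eq_of_ne] at h
  intro h
  have := congrArg Fin.val h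
  simp at this
  omega

/-- A sequence can be built by choosing each term according to its predecessors. -/
theorem exists_seq_of_forall_initial {E : Type*} (p : (n : ℕ) → ((m : ℕ) → m < n → E) → E → Prop)
    (h : ∀ n g, ∃ y, p n g y) : ∃ y : ℕ → E, ∀ n, p n (fun m _ => y m) (y n) := by
  choose c hc using h
  refine ⟨fun n => Nat.strongRec (fun n g => c n g) n, fun n => ?_⟩
  dsimp only
  conv => arg 3; rw [Nat.strongRec_eq]
  exact hc _ _

/-- A linear map which is bounded, up to a fixed gauge `N`, after composition with every
bounded operator on its domain is continuous. -/
theorem LinearMap.continuous_of_forall_comp_bound {E G : Type*} [NormedAddCommGroup E]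
    [NormedSpace ℂ E] [CompleteSpace E] [NormedAddCommGroup G] [NormedSpace ℂ G]
    (T : E →ₗ[ℂ] G) (N : E → ℝ)
    (h : ∀ A : E →L[ℂ] E, ∃ C : ℝ, ∀ x, ‖T (A x)‖ ≤ C * N x) : Continuous T := by
  by_cases hfin : FiniteDimensional ℂ E
  · exact T.continuous_of_finiteDimensional
  by_contra hT
  have hunb : ∀ ε > 0, ∀ R : ℝ, ∃ y, ‖y‖ ≤ ε ∧ R ≤ ‖T y‖ := by
    by_contra! hcon
    obtain ⟨ε, hε, R, hR⟩ := hcon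
    obtain ⟨C, hC⟩ := T.bound_of_ball_bound hε R
      (fun z hz => (hR z (by simpa using (mem_ball_zero_iff.mp hz).le)).le)
    exact hT (T.mkContinuous C hC).continuous
  obtain ⟨e, he⟩ : ∃ e : ℕ → E, LinearIndependent ℂ e := by
    let b := Module.Basis.ofVectorSpace ℂ E
    have : Infinite (Module.Basis.ofVectorSpaceIndex ℂ E) := by
      by_contra hf
      rw [not_infinite_iff_finite] at hf
      exact hfin (Module.Finite.of_basis b)
    exact ⟨_, b.linearIndependent.comp _ (Infinite.natEmbedding _).injective⟩
  choose f hf1 hf0 using fun n => he.exists_strongDual_triangular n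
  obtain ⟨y, hy⟩ := exists_seq_of_forall_initial
    (fun n (g : (m : ℕ) → m < n → E) y => ‖y‖ ≤ (1 / 2) ^ n / (‖f n‖ + 1) ∧
      n * |N (e n)| + 1 + ‖∑ m : Fin n, f m (e n) • T (g m m.2)‖ ≤ ‖T y‖)
    (fun n g => hunb _ (by positivity) _)
  let a : ℕ → E →L[ℂ] E := fun n => (f n).smulRight (y n)
  have ha : Summable a := by
    refine Summable.of_norm_bounded (summable_geometric_of_lt_one (r := (1 / 2 : ℝ))
      (by norm_num) (by norm_num)) fun n => ?_
    simp only [a, ContinuousLinearMap.norm_smulRight_apply]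
    calc ‖f n‖ * ‖y n‖ ≤ (‖f n‖ + 1) * ((1 / 2) ^ n / (‖f n‖ + 1)) := by
          gcongr
          · linarith
          · exact (hy n).1
      _ = (1 / 2) ^ n := by field_simp
  obtain ⟨C, hC⟩ := h (∑' n, a n)
  have hval : ∀ n, (∑' m, a m) (e n) = ∑ m ∈ Finset.range (n + 1), f m (e n) • y m := by
    intro n
    have h1 : HasSum (fun m => a m (e n)) ((∑' m, a m) (e n)) :=
      ha.hasSum.mapL (ContinuousLinearMap.apply ℂ E (e n))
    refine h1.unique (hasSum_sum_of_ne_finset_zero fun m hm => ?_)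
    simp only [Finset.mem_range, not_lt] at hm
    simp [a, hf0 m n (by omega)]
  obtain ⟨n, hn⟩ := exists_nat_ge |C|
  have h1 := hC (e n)
  rw [hval, Finset.sum_range_succ, hf1, one_smul, map_add, map_sum, Finset.sum_range] at h1
  simp only [map_smul] at h1
  have h2 := norm_sub_norm_le (T (y n)) (-∑ m : Fin n, f m (e n) • T (y m))
  rw [norm_neg, sub_neg_eq_add, add_comm (T (y n))] at h2
  have h3 := (hy n).2
  have h4 : C * N (e n) ≤ n * |N (e n)| :=
    (le_abs_self _).trans ((abs_mul _ _).trans_le (by gcongr))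
  linarith

namespace FockSetup

/-- The vectors `τ k d b₀` together with `BΩ` separate bounded operators. -/
theorem ext_operator (S : FockSetup B I F) {T T' : F →L[ℂ] F}
    (hΩ : ∀ b, T (S.lam b S.Ω) = T' (S.lam b S.Ω))
    (hτ : ∀ k d b₀, T (S.τ k d b₀) = T' (S.τ k d b₀)) : T = T' := by
  refine ContinuousLinearMap.ext_on S.dense_span ?_
  rintro x (⟨b, rfl⟩ | ⟨k, d, b₀, rfl⟩)
  · exact hΩ b
  · exact hτ k d b₀

/-- The map `b ↦ λ(b) x` is continuous as soon as all vectors `λ(A y) x` are obtained by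
applying a bounded operator depending only on `A` to a vector depending only on `y`. -/
theorem continuous_lam_apply_of_factor (S : FockSetup B I F) (x : F) (g : B → F)
    (U : (B →L[ℂ] B) → F →L[ℂ] F) (h : ∀ A y, U A (g y) = S.lam (A y) x) :
    Continuous fun b => S.lam b x :=
  LinearMap.continuous_of_forall_comp_bound
    ((LinearMap.applyₗ x).comp ((ContinuousLinearMap.coeLM ℂ).comp S.lam.toLinearMap))
    (fun y => ‖g y‖) fun A => ⟨‖U A‖, fun y => by
      have := (U A).le_opNorm (g y)
      rw [h] at this
      exact this⟩

theorem continuous_lam_omega (S : FockSetup B I F) (i : I) :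
    Continuous fun b => S.lam b S.Ω := by
  refine S.continuous_lam_apply_of_factor _ (fun y => S.τ 0 (fun _ => lp.single 1 i y) 1)
    (fun A => S.V i 1 (ContinuousMultilinearMap.ofSubsingleton ℂ B B (0 : Fin 1) A)) fun A y => ?_
  rw [S.V_tensor_eq]
  simp

theorem continuous_lam_tensor (S : FockSetup B I F) (i : I) (k : ℕ) (d : Fin (k + 1) → D B I)
    (b₀ : B) : Continuous fun b => S.lam b (S.τ k d b₀) := by
  refine S.continuous_lam_apply_of_factor _
    (fun y => S.τ (k + 1) (Fin.cons (lp.single 1 i y) d : Fin (k + 2) → D B I) b₀)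
    (fun A => S.V i 1 (ContinuousMultilinearMap.ofSubsingleton ℂ B B (0 : Fin 1) A)) fun A y => ?_
  rw [S.V_tensor_gt i 1 le_rfl _ (k + 1) _ _ (by omega)]
  have hd : (fun j : Fin (k + 1) =>
      (Fin.cons (lp.single 1 i y) d : Fin (k + 2) → D B I) ⟨1 + (j : ℕ), by omega⟩) = d := by
    funext j
    have : (⟨1 + (j : ℕ), by omega⟩ : Fin (k + 2)) = j.succ := by
      ext
      simp [add_comm]
    rw [this, Fin.cons_succ]
  have hA : (ContinuousMultilinearMap.ofSubsingleton ℂ B B (0 : Fin 1) A) (fun j : Fin 1 =>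
      (Fin.cons (lp.single 1 i y) d : Fin (k + 2) → D B I) (Fin.castLE (by omega) j) i) = A y := by
    simp
  exact congrArg₂ (fun a e => S.lam a (S.τ k e b₀)) hA hd

/-- The left action of `B` on the Fock space is automatically continuous. -/
theorem continuous_lam (S : FockSetup B I F) (i : I) : Continuous S.lam := by
  refine LinearMap.continuous_of_seq_closed_graph (g := S.lam.toLinearMap) fun u b T hu hT => ?_
  have key : ∀ x, (Continuous fun b => S.lam b x) → T x = S.lam b x := fun x hx =>
    tendsto_nhds_unique (((ContinuousLinearMap.apply ℂ F x).continuous.tendsto T).comp hT)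
      ((hx.tendsto b).comp hu)
  refine S.ext_operator (fun a => key _ ?_) fun k d b₀ => key _ (S.continuous_lam_tensor i k d b₀)
  simpa [Function.comp_def] using (S.continuous_lam_omega i).comp (continuous_mul_const a)

theorem lam_mul_L_pow_succ (S : FockSetup B I F) (i : I) (b β : B) (k : ℕ) :
    ((S.lam b * S.L i) ^ (k + 1)) (S.lam β S.Ω) =
      S.τ k (fun _ => lsmul B I b (delta B I i)) β := by
  induction k with
  | zero =>
    simp only [zero_add, pow_one]
    rw [mul_apply_eq_comp, S.L_omega, S.lam_tensor]
    congr 1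
    funext j
    rw [Fin.eq_zero j, Function.update_self]
  | succ k ih =>
    rw [pow_succ', mul_apply_eq_comp, ih, mul_apply_eq_comp, S.L_tensor,
      S.lam_tensor]
    congr 1
    funext j
    refine Fin.cases ?_ (fun j => ?_) j
    · simp
    · rw [Function.update_of_ne (Fin.succ_ne_zero j), Fin.cons_succ]

theorem lsmul_delta_apply_self (b : B) (i : I) : lsmul B I b (delta B I i) i = b := by
  change b * (lp.single 1 i (1 : B) : D B I) i = b
  simp

section GeometricVector

variable (S : FockSetup B I F) (i : I) (n k : ℕ)
  (A : ContinuousMultilinearMap ℂ (fun _ : Fin n => B) B) (b β : B)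

theorem V_pow_of_lt (h : k < n) :
    S.V i n A (((S.lam b * S.L i) ^ k) (S.lam β S.Ω)) = 0 := by
  cases k with
  | zero => exact S.V_omega i n h A β
  | succ k => rw [lam_mul_L_pow_succ, S.V_tensor_lt i n A k _ _ h]

theorem W_pow_of_lt (h : k < n) :
    S.W i n A (((S.lam b * S.L i) ^ k) (S.lam β S.Ω)) = 0 := by
  cases k with
  | zero => exact S.W_omega i n h A β
  | succ k => rw [lam_mul_L_pow_succ, S.W_tensor_lt i n A k _ _ h]

theorem V_pow_add :
    S.V i n A (((S.lam b * S.L i) ^ (k + n)) (S.lam β S.Ω)) =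
      S.lam (A fun _ => b) (((S.lam b * S.L i) ^ k) (S.lam β S.Ω)) := by
  cases n with
  | zero =>
    rw [S.V_zero, add_zero, Subsingleton.elim (fun _ : Fin 0 => b) 0]
  | succ n =>
    cases k with
    | zero =>
      rw [zero_add, lam_mul_L_pow_succ, S.V_tensor_eq]
      simp [lsmul_delta_apply_self]
    | succ k =>
      rw [← add_assoc, lam_mul_L_pow_succ, lam_mul_L_pow_succ,
        S.V_tensor_gt i (n + 1) (by omega) A _ _ _ (by omega)]
      simp only [lsmul_delta_apply_self]
      have : k + 1 + n - (n + 1) = k := by omega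
      rw [this]

theorem W_pow_add :
    S.W i n A (((S.lam b * S.L i) ^ (k + n)) (S.lam β S.Ω)) =
      S.lam (A fun _ => b) (S.L i (((S.lam b * S.L i) ^ k) (S.lam β S.Ω))) := by
  cases n with
  | zero =>
    rw [S.W_zero, add_zero, Subsingleton.elim (fun _ : Fin 0 => b) 0]
    rfl
  | succ n =>
    cases k with
    | zero =>
      rw [zero_add, lam_mul_L_pow_succ, S.W_tensor_eq, pow_zero, one_apply_eq_self,
        S.L_omega]
      simp only [lsmul_delta_apply_self]
    | succ k =>
      rw [← add_assoc, lam_mul_L_pow_succ, lam_mul_L_pow_succ, S.L_tensor,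
        S.W_tensor_gt i (n + 1) (by omega) A _ _ _ (by omega)]
      simp only [lsmul_delta_apply_self]
      have : k + 1 + n - (n + 1) = k := by omega
      rw [this]

/-- The vector `∑ₖ (bδᵢ)^{⊗k} ⊗ β`. -/
def geomVector : F := ∑' k, ((S.lam b * S.L i) ^ k) (S.lam β S.Ω)

variable {b}

theorem hasSum_geomVector (hb : ‖S.lam b * S.L i‖ < 1) :
    HasSum (fun k => ((S.lam b * S.L i) ^ k) (S.lam β S.Ω)) (S.geomVector i b β) :=
  ((summable_geometric_of_norm_lt_one hb).mapL
    (ContinuousLinearMap.apply ℂ F (S.lam β S.Ω))).hasSum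

theorem lam_L_geomVector (hb : ‖S.lam b * S.L i‖ < 1) :
    S.lam b (S.L i (S.geomVector i b β)) = S.geomVector i b β - S.lam β S.Ω := by
  have h := S.hasSum_geomVector i β hb
  have h1 := (hasSum_nat_add_iff' 1).mpr h
  rw [Finset.sum_range_one, pow_zero, one_apply_eq_self] at h1
  simp only [pow_succ', mul_apply_eq_comp] at h1
  exact (h.mapL (S.lam b * S.L i)).unique h1

theorem P_geomVector (hb : ‖S.lam b * S.L i‖ < 1) : S.P (S.geomVector i b β) = β := by
  refine ((S.hasSum_geomVector i β hb).mapL S.P).unique ?_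
  have h0 : S.P (((S.lam b * S.L i) ^ 0) (S.lam β S.Ω)) = β := by simp [S.P_lam_omega]
  have h1 := hasSum_single (f := fun k => S.P (((S.lam b * S.L i) ^ k) (S.lam β S.Ω))) 0 ?_
  · rwa [h0] at h1
  intro k hk
  obtain ⟨k, rfl⟩ := Nat.exists_eq_succ_of_ne_zero hk
  rw [lam_mul_L_pow_succ, S.P_tensor]

theorem V_geomVector (hb : ‖S.lam b * S.L i‖ < 1) :
    S.V i n A (S.geomVector i b β) = S.lam (A fun _ => b) (S.geomVector i b β) := by
  have h := S.hasSum_geomVector i β hb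
  have h1 := (hasSum_nat_add_iff' n).mpr (h.mapL (S.V i n A))
  rw [Finset.sum_eq_zero fun k hk => S.V_pow_of_lt i n k A b β (Finset.mem_range.mp hk),
    sub_zero] at h1
  simp only [V_pow_add] at h1
  exact h1.unique (h.mapL _)

theorem W_geomVector (hb : ‖S.lam b * S.L i‖ < 1) :
    S.W i n A (S.geomVector i b β) = S.lam (A fun _ => b) (S.L i (S.geomVector i b β)) := by
  have h := S.hasSum_geomVector i β hb
  have h1 := (hasSum_nat_add_iff' n).mpr (h.mapL (S.W i n A))
  rw [Finset.sum_eq_zero fun k hk => S.W_pow_of_lt i n k A b β (Finset.mem_range.mp hk),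
    sub_zero] at h1
  simp only [W_pow_add] at h1
  exact h1.unique (h.mapL (S.lam _ * S.L i))

end GeometricVector

theorem sum_apply_geomVector (S : FockSetup B I F) (i : I) (N : ℕ)
    (α : (n : ℕ) → ContinuousMultilinearMap ℂ (fun _ : Fin n => B) B) {b : B} (β : B)
    (hb : ‖S.lam b * S.L i‖ < 1) :
    (∑ n ∈ Finset.range (N + 1), (S.V i n (α n) + S.W i n (α n))) (S.geomVector i b β) =
      S.lam (∑ n ∈ Finset.range (N + 1), α n fun _ => b)
        (S.geomVector i b β + S.L i (S.geomVector i b β)) := by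
  rw [map_sum, sum_apply, sum_apply]
  refine Finset.sum_congr rfl fun n _ => ?_
  rw [add_apply, V_geomVector _ _ _ _ _ hb, W_geomVector _ _ _ _ _ hb, map_add]

theorem Psi_sum (S : FockSetup B I F) (i : I) (N : ℕ)
    (α : (n : ℕ) → ContinuousMultilinearMap ℂ (fun _ : Fin n => B) B) {X : F →L[ℂ] F}
    (hX : X = ∑ n ∈ Finset.range (N + 1), (S.V i n (α n) + S.W i n (α n))) {b : B}
    (hb : ‖S.lam b * S.L i‖ < 1) {c u f : B} (hu : u * (1 + b) = 1) (hu' : (1 + b) * u = 1)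
    (hf : f * ∑ n ∈ Finset.range (N + 1), (α n fun _ => b) = 1) (hc : c = b * (u * f))
    (hcX : IsUnit (1 - S.lam c * X)) : S.Psi X c = b := by
  set v := S.geomVector i b (1 + b) with hv
  have hbu : b * u = u * b := by
    calc b * u = (u * (1 + b)) * (b * u) := by rw [hu, one_mul]
      _ = u * (b * ((1 + b) * u)) := by noncomm_ring
      _ = u * b := by rw [hu', mul_one]
  have h1 : S.lam c (X v) = v - S.Ω := by
    rw [hX, S.sum_apply_geomVector i N α _ hb, ← mul_apply_eq_comp, ← map_mul, hc, mul_assoc,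
      mul_assoc, hf, mul_one, hbu, map_mul, mul_apply_eq_comp, map_add (S.lam b),
      S.lam_L_geomVector i _ hb, ← hv]
    have h2 : S.lam b v + (v - S.lam (1 + b) S.Ω) = S.lam (1 + b) (v - S.Ω) := by
      simp only [map_add, map_one, map_sub, add_apply, one_apply_eq_self]
      abel
    rw [h2, ← mul_apply_eq_comp, ← map_mul, hu, map_one, one_apply_eq_self]
  have h2 : (1 - S.lam c * X) v = S.Ω := by
    rw [sub_apply, one_apply_eq_self, mul_apply_eq_comp, h1, sub_sub_cancel]
  have h3 : Ring.inverse (1 - S.lam c * X) S.Ω = v := by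
    rw [← h2, ← mul_apply_eq_comp, Ring.inverse_mul_cancel _ hcX, one_apply_eq_self]
  rw [Psi, Ec, h3, hv, S.P_geomVector i _ hb, add_sub_cancel_left]

theorem Ec_lam_mul_sum (S : FockSetup B I F) (i : I) (N : ℕ)
    (α : (n : ℕ) → ContinuousMultilinearMap ℂ (fun _ : Fin n => B) B) (b : B) :
    S.Ec (S.lam b * ∑ n ∈ Finset.range (N + 1), (S.V i n (α n) + S.W i n (α n))) = b * α 0 0 := by
  have hΩ : S.lam 1 S.Ω = S.Ω := by simp
  rw [Ec, mul_apply_eq_comp, sum_apply, Finset.sum_range_succ', Finset.sum_eq_zero, zero_add,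
    add_apply, S.V_zero, S.W_zero, map_add, mul_apply_eq_comp, ← mul_apply_eq_comp, ← map_mul,
    ← mul_apply_eq_comp (S.lam b), ← map_mul, map_add, S.P_lam_omega]
  · nth_rewrite 1 [← hΩ]
    rw [S.L_omega, S.lam_tensor, S.P_tensor, add_zero]
  · intro n _
    rw [← hΩ, add_apply, S.V_omega i _ (by omega), S.W_omega i _ (by omega), add_zero]

/-- `Ψ_X` has strict derivative `b ↦ ℰ(b X)` at the origin. -/
theorem hasStrictFDerivAt_Psi (S : FockSetup B I F) (hS : Continuous S.lam) (X : F →L[ℂ] F)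
    (e : B →L[ℂ] B) (he : ∀ b, e b = S.Ec (S.lam b * X)) : HasStrictFDerivAt (S.Psi X) e 0 := by
  let lamL : B →L[ℂ] F →L[ℂ] F := ⟨S.lam.toLinearMap, hS⟩
  let R : B →L[ℂ] F →L[ℂ] F := ((ContinuousLinearMap.mul ℂ (F →L[ℂ] F)).flip X).comp lamL
  let E : (F →L[ℂ] F) →L[ℂ] B := S.P.comp (ContinuousLinearMap.apply ℂ F S.Ω)
  have h1 : HasStrictFDerivAt (fun b => 1 - R b) (-R) 0 := R.hasStrictFDerivAt.const_sub 1
  have h2 := hasStrictFDerivAt_ringInverse (𝕜 := ℂ) (1 : (F →L[ℂ] F)ˣ)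
  have h3 : HasStrictFDerivAt (fun b => E (Ring.inverse (1 - R b)) - 1)
      (E.comp ((-ContinuousLinearMap.mulLeftRight ℂ (F →L[ℂ] F) ↑(1 : (F →L[ℂ] F)ˣ)⁻¹
        ↑(1 : (F →L[ℂ] F)ˣ)⁻¹).comp (-R))) 0 := by
    refine (E.hasStrictFDerivAt.comp 0 (HasStrictFDerivAt.comp 0 ?_ h1)).sub_const 1
    simpa using h2
  have hR : ∀ b, R b = S.lam b * X := fun b => rfl
  have hE : ∀ T, E T = S.Ec T := fun T => rfl
  refine h3.congr_fderiv ?_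
  ext b
  simp [he, hR, hE]

end FockSetup

/-- Near the origin, an analytic function `H` on a unital Banach algebra is determined by
`b ↦ b H(b)`. -/
theorem AnalyticAt.eventuallyEq_of_id_mul_eventuallyEq {G H : B → B} (hG : AnalyticAt ℂ G 0)
    (hH : AnalyticAt ℂ H 0) (h : ∀ᶠ b in 𝓝 (0 : B), b * G b = b * H b) : G =ᶠ[𝓝 0] H := by
  obtain ⟨r, hr, hball⟩ := Metric.eventually_nhds_iff_ball.mp
    ((hG.eventually_analyticAt.and hH.eventually_analyticAt).and h)
  have hconn : IsPreconnected (Metric.ball (0 : B) r) :=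
    (convex_ball (0 : B) r).isPreconnected
  obtain ⟨t, ht0, ht⟩ : ∃ t : ℂ, t ≠ 0 ∧ t • (1 : B) ∈ Metric.ball (0 : B) r := by
    have hc : ContinuousAt (fun t : ℂ => t • (1 : B)) 0 := by fun_prop
    have := hc.eventually_mem (s := Metric.ball (0 : B) r)
      (by simpa using Metric.ball_mem_nhds (0 : B) hr)
    obtain ⟨t, h1, h2⟩ := ((this.filter_mono nhdsWithin_le_nhds).and
      (self_mem_nhdsWithin : {(0 : ℂ)}ᶜ ∈ 𝓝[≠] (0 : ℂ))).exists
    exact ⟨t, h2, h1⟩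
  have hunit : IsUnit (t • (1 : B)) := by
    rw [← Algebra.algebraMap_eq_smul_one]
    exact (IsUnit.mk0 t ht0).map _
  have hloc : G =ᶠ[𝓝 (t • (1 : B))] H := by
    filter_upwards [Metric.isOpen_ball.mem_nhds ht, Units.isOpen.mem_nhds hunit] with b hb hbu
    exact IsUnit.mul_left_cancel hbu (hball b hb).2
  have := AnalyticOnNhd.eqOn_of_preconnected_of_eventuallyEq (𝕜 := ℂ)
    (fun b hb => (hball b hb).1.1) (fun b hb => (hball b hb).1.2) hconn ht hloc
  filter_upwards [Metric.ball_mem_nhds (0 : B) hr] with b hb using this hb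

/-- Lemma 3.6: for `X = ∑_{n=0}^{N} (V_{1,n}(αₙ) + W_{1,n}(αₙ))` (here the index `1 ∈ {1,2}`
is `(0 : Fin 2)`), with `α₀` invertible and `F(b) = α₀ + ∑_{n=1}^N αₙ(b,…,b)`, the
S-transform of `X` is `S_X(b) = F(b)⁻¹`. -/
theorem stmt_11 (S : FockSetup B (Fin 2) F) (N : ℕ) (hN : 1 ≤ N)
    (α : (n : ℕ) → ContinuousMultilinearMap ℂ (fun _ : Fin n => B) B)
    (hinv : IsUnit (α 0 0))
    (X : F →L[ℂ] F)
    (hX : X = ∑ n ∈ Finset.range (N + 1), (S.V 0 n (α n) + S.W 0 n (α n))) :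
    ∀ Sx : B → B, S.IsSTransform X Sx →
      ∀ᶠ b in nhds (0 : B),
        Sx b = Ring.inverse (∑ n ∈ Finset.range (N + 1), α n (fun _ => b)) := by
  intro Sx ⟨H, hH, hPsi, hSx⟩
  have hlam := S.continuous_lam 0
  set f : B → B := fun b => ∑ n ∈ Finset.range (N + 1), α n fun _ => b with hf
  have hfa : AnalyticAt ℂ f 0 := by
    refine Finset.analyticAt_fun_sum _ fun n _ => ?_
    exact AnalyticAt.fun_comp (α n).analyticAt (AnalyticAt.pi fun _ => analyticAt_id)
  have hf0 : f 0 = α 0 0 := by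
    rw [hf]
    dsimp only
    rw [Finset.sum_range_succ', Finset.sum_eq_zero, zero_add]
    · congr 1
    · intro n _
      exact (α (n + 1)).map_coord_zero 0 rfl
  obtain ⟨a, ha⟩ := hinv
  have hfinv : AnalyticAt ℂ (fun b => Ring.inverse (f b)) 0 :=
    AnalyticAt.fun_comp (by rw [hf0, ← ha]; exact analyticAt_inverse a) hfa
  have huinv : AnalyticAt ℂ (fun b : B => Ring.inverse (1 + b)) 0 :=
    AnalyticAt.fun_comp (g := Ring.inverse) (by simpa using analyticAt_inverse (𝕜 := ℂ) (1 : Bˣ))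
      (analyticAt_const.add analyticAt_id)
  set G : B → B := fun b => Ring.inverse (1 + b) * Ring.inverse (f b) with hG
  have hGa : AnalyticAt ℂ G 0 := huinv.mul hfinv
  have hu : ∀ᶠ b : B in 𝓝 0, IsUnit (1 + b) := by
    have hc : ContinuousAt (fun b : B => 1 + b) 0 := by fun_prop
    exact hc.eventually_mem (Units.isOpen.mem_nhds (by simp))
  have hfu : ∀ᶠ b : B in 𝓝 0, IsUnit (f b) :=
    hfa.continuousAt.eventually_mem (Units.isOpen.mem_nhds (by rw [hf0, ← ha]; exact a.isUnit))
  have hL : ∀ᶠ b : B in 𝓝 0, ‖S.lam b * S.L 0‖ < 1 := by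
    have hc : ContinuousAt (fun b : B => ‖S.lam b * S.L 0‖) 0 := by fun_prop
    exact hc.eventually_lt_const (by simp)
  have hzero : ∀ K : B → B, AnalyticAt ℂ K 0 → Filter.Tendsto (fun b => b * K b) (𝓝 0) (𝓝 0) := by
    intro K hK
    have hc : ContinuousAt (fun b => b * K b) 0 := continuousAt_id.mul hK.continuousAt
    simpa [ContinuousAt] using hc
  have hX1 : ∀ᶠ c : B in 𝓝 0, IsUnit (1 - S.lam c * X) := by
    have hc : ContinuousAt (fun c : B => 1 - S.lam c * X) 0 := by fun_prop
    exact hc.eventually_mem (Units.isOpen.mem_nhds (by simp))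
  have hPsiG : ∀ᶠ b in 𝓝 (0 : B), S.Psi X (b * G b) = b := by
    filter_upwards [hu, hfu, hL, (hzero G hGa).eventually hX1] with b h1 h2 h3 h4
    exact S.Psi_sum 0 N α hX h3 (Ring.inverse_mul_cancel _ h1) (Ring.mul_inverse_cancel _ h1)
      (Ring.inverse_mul_cancel _ h2) rfl h4
  let e : B ≃L[ℂ] B := ContinuousLinearEquiv.equivOfInverse
    ((ContinuousLinearMap.mul ℂ B).flip a) ((ContinuousLinearMap.mul ℂ B).flip ↑a⁻¹)
    (fun b => by simp) (fun b => by simp)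
  have hder : HasStrictFDerivAt (S.Psi X) (e : B →L[ℂ] B) 0 :=
    S.hasStrictFDerivAt_Psi hlam X e fun b => by
      rw [hX, S.Ec_lam_mul_sum, ← ha]
      rfl
  have hinj := hder.eventually_left_inverse
  have hGH : ∀ᶠ b in 𝓝 (0 : B), b * G b = b * H b := by
    filter_upwards [(hzero G hGa).eventually hinj, (hzero H hH).eventually hinj, hPsiG, hPsi]
      with b h1 h2 h3 h4
    rw [← h1, h3, ← h2, h4]
  filter_upwards [hGa.eventuallyEq_of_id_mul_eventuallyEq hH hGH, hSx, hu] with b h1 h2 h3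
  rw [h2, ← h1, hG]
  exact Ring.mul_inverse_cancel_left _ _ h3
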